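/- arXiv:2011.13828 — 9 statements merged into one kernel-verified Lean document; each statement's English description precedes it below -/
import Mathlib

section
/- For every real number a > 0 there exist constants C₁(a) > 0 and C₂(a) > 0 such that for every m > 0 and every t > 0, ∫₀^∞ r^a e^{-t(r - m/(2r))²} dr ≤ C₁(a) m^{a/2} t^{-1/2} + C₂(a) t^{-(1+a)/2}. -/
open Real MeasureTheory

theorem sq_sub_sqrt_le_sq_sub_div {m r : ℝ} (hm : 0 < m) (hr : 0 < r) :
    (r - √(m / 2)) ^ 2 ≤ (r - m / (2 * r)) ^ 2 := by
  set c := √(m / 2) with hc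
  have hc0 : 0 ≤ c := Real.sqrt_nonneg _
  have hmc : m = 2 * c ^ 2 := by rw [hc, Real.sq_sqrt (by positivity)]; ring
  have hfactor : r - m / (2 * r) = (r - c) * (1 + c / r) := by
    rw [hmc]; field_simp; ring
  rw [hfactor, mul_pow]
  have h1 : 1 ≤ (1 + c / r) ^ 2 := one_le_pow₀ (by linarith [div_nonneg hc0 hr.le])
  exact le_mul_of_one_le_right (sq_nonneg _) h1

theorem rpow_le_two_rpow_mul_add_abs_sub {a c r : ℝ} (ha : 0 ≤ a) (hc : 0 ≤ c) (hr : 0 ≤ r) :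
    r ^ a ≤ 2 ^ a * (c ^ a + |r - c| ^ a) := by
  have hc' := rpow_nonneg hc a
  have habs := rpow_nonneg (abs_nonneg (r - c)) a
  have hle : r ≤ 2 * max c |r - c| := by
    linarith [le_max_left c |r - c|, le_max_right c |r - c|, le_abs_self (r - c)]
  calc r ^ a ≤ (2 * max c |r - c|) ^ a := rpow_le_rpow hr hle ha
    _ = 2 ^ a * (max c |r - c|) ^ a := mul_rpow (by norm_num) (by positivity)
    _ ≤ 2 ^ a * (c ^ a + |r - c| ^ a) := by
      gcongr
      rcases max_choice c |r - c| with h | h <;> rw [h] <;> linarith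

theorem integral_abs_rpow_mul_exp_neg_mul_sq {a t : ℝ} (ha : 0 ≤ a) (ht : 0 < t) :
    ∫ x : ℝ, |x| ^ a * Real.exp (-t * x ^ 2) = Real.Gamma ((a + 1) / 2) * t ^ (-(1 + a) / 2) := by
  have h := integral_comp_abs (f := fun x : ℝ => x ^ a * Real.exp (-t * x ^ 2))
  simp only [sq_abs] at h
  have h2 := integral_rpow_mul_exp_neg_mul_rpow (p := 2) (q := a) (b := t) (by norm_num)
    (by linarith) ht
  simp only [rpow_two] at h2
  rw [h, h2, add_comm 1 a]
  ring

theorem integrable_abs_rpow_mul_exp_neg_mul_sq {a t : ℝ} (ha : 0 ≤ a) (ht : 0 < t) :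
    Integrable fun x : ℝ => |x| ^ a * Real.exp (-t * x ^ 2) := by
  have hΓ : 0 < Real.Gamma ((a + 1) / 2) := Real.Gamma_pos_of_pos (by linarith)
  refine Integrable.of_integral_ne_zero ?_
  rw [integral_abs_rpow_mul_exp_neg_mul_sq ha ht]
  positivity

/-- Lemma 2.3: for every `a > 0` there are constants `C₁, C₂ > 0` such that for all
`m > 0` and `t > 0`, `∫₀^∞ r^a e^{-t(r - m/(2r))²} dr ≤ C₁ m^{a/2} t^{-1/2} + C₂ t^{-(1+a)/2}`. -/
theorem integral_rpow_exp_shifted_bound (a : ℝ) (ha : 0 < a) :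
    ∃ C₁ > (0 : ℝ), ∃ C₂ > (0 : ℝ), ∀ m : ℝ, 0 < m → ∀ t : ℝ, 0 < t →
      (∫ r in Set.Ioi (0 : ℝ), r ^ a * Real.exp (-t * (r - m / (2*r))^2))
        ≤ C₁ * m ^ (a/2) * t ^ (-(1 : ℝ)/2) + C₂ * t ^ (-(1 + a)/2) := by
  have hΓ : 0 < Real.Gamma ((a + 1) / 2) := Real.Gamma_pos_of_pos (by linarith)
  refine ⟨2 ^ a * √π, by positivity, 2 ^ a * Real.Gamma ((a + 1) / 2), by positivity, ?_⟩
  intro m hm t ht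
  set c := √(m / 2) with hc
  have hc0 : 0 ≤ c := Real.sqrt_nonneg _
  have hca : c ^ a ≤ m ^ (a / 2) := by
    rw [hc, sqrt_eq_rpow, ← rpow_mul (by positivity), one_div_mul_eq_div]
    exact rpow_le_rpow (by positivity) (by linarith) (by positivity)
  let g : ℝ → ℝ := fun x =>
    2 ^ a * (c ^ a * Real.exp (-t * x ^ 2) + |x| ^ a * Real.exp (-t * x ^ 2))
  have hexp := (integrable_exp_neg_mul_sq ht).const_mul (c ^ a)
  have hpow := integrable_abs_rpow_mul_exp_neg_mul_sq ha.le ht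
  have hg : Integrable g := (hexp.add hpow).const_mul _
  have hg_shift : Integrable fun r => g (r - c) := hg.comp_sub_right c
  have hg_integral : ∫ x, g x =
      2 ^ a * (c ^ a * √(π / t) + Real.Gamma ((a + 1) / 2) * t ^ (-(1 + a) / 2)) := by
    simp only [g]
    rw [integral_const_mul, integral_add hexp hpow, integral_const_mul, integral_gaussian,
      integral_abs_rpow_mul_exp_neg_mul_sq ha.le ht]
  have hsqrt : √(π / t) = √π * t ^ (-(1 : ℝ) / 2) := by
    rw [sqrt_div' _ ht.le, sqrt_eq_rpow t, neg_div, rpow_neg ht.le, div_eq_mul_inv]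
  calc ∫ r in Set.Ioi (0 : ℝ), r ^ a * Real.exp (-t * (r - m / (2*r))^2)
      ≤ ∫ r in Set.Ioi (0 : ℝ), g (r - c) := by
        refine integral_mono_of_nonneg ?_ hg_shift.integrableOn ?_
        · filter_upwards [ae_restrict_mem measurableSet_Ioi] with r hr
          exact mul_nonneg (rpow_nonneg (le_of_lt hr) a) (Real.exp_pos _).le
        · filter_upwards [ae_restrict_mem measurableSet_Ioi] with r hr
          have hr : 0 < r := hr
          have hle : Real.exp (-t * (r - m / (2 * r)) ^ 2) ≤ Real.exp (-t * (r - c) ^ 2) :=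
            Real.exp_le_exp.2 (mul_le_mul_of_nonpos_left (sq_sub_sqrt_le_sq_sub_div hm hr)
              (by linarith))
          calc r ^ a * Real.exp (-t * (r - m / (2 * r)) ^ 2)
              ≤ 2 ^ a * (c ^ a + |r - c| ^ a) * Real.exp (-t * (r - c) ^ 2) :=
                mul_le_mul (rpow_le_two_rpow_mul_add_abs_sub ha.le hc0 hr.le) hle
                  (Real.exp_pos _).le (by positivity)
            _ = g (r - c) := by simp only [g]; ring
    _ ≤ ∫ r, g (r - c) :=
        setIntegral_le_integral hg_shift (.of_forall fun r => by simp only [g]; positivity)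
    _ = ∫ x, g x := integral_sub_right_eq_self g c
    _ = 2 ^ a * √π * c ^ a * t ^ (-(1 : ℝ) / 2) +
          2 ^ a * Real.Gamma ((a + 1) / 2) * t ^ (-(1 + a) / 2) := by
        rw [hg_integral, hsqrt]; ring
    _ ≤ _ := by gcongr
end

section
/- For every real a > 0, every m > 0 and every t > 0, ∫₀^{√(m/2)} r^a e^{-t(r - m/(2r))²} dr ≤ 2^{-1-a} (2m)^{a/2} (√π/2) t^{-1/2}. -/
open Real MeasureTheory

/-- First half of the proof of Lemma 2.3: for `a > 0`, `m > 0`, `t > 0`,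
`∫₀^{√(m/2)} r^a e^{-t(r-m/(2r))²} dr ≤ 2^{-1-a} (2m)^{a/2} (√π/2) t^{-1/2}`. -/
theorem integral_rpow_exp_shifted_lower_part (a m t : ℝ) (ha : 0 < a) (hm : 0 < m)
    (ht : 0 < t) :
    (∫ r in Set.Ioo (0 : ℝ) (Real.sqrt (m/2)), r ^ a * Real.exp (-t * (r - m / (2*r))^2))
      ≤ (2 : ℝ) ^ (-1 - a) * (2*m) ^ (a/2) * (Real.sqrt π / 2) * t ^ (-(1 : ℝ)/2) := by
  set S := Set.Ioo (0 : ℝ) (√(m/2)) with hS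
  have hsq : ∀ r ∈ S, r ^ 2 < m / 2 := fun r hr => (Real.lt_sqrt hr.1.le).1 hr.2
  have hder : ∀ r ∈ S,
      HasDerivWithinAt (fun r : ℝ => r - m / (2*r)) (1 + m / (2*r^2)) S r := by
    intro r hr
    have hr0 : r ≠ 0 := hr.1.ne'
    have h := (hasDerivAt_id r).sub
      ((hasDerivAt_const r m).div ((hasDerivAt_id r).const_mul 2) (by simpa using hr0))
    convert! h.hasDerivWithinAt using 1
    simp only [id]
    field_simp
    ring
  have hinj : Set.InjOn (fun r : ℝ => r - m / (2*r)) S := by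
    refine StrictMonoOn.injOn fun x hx y hy hxy => ?_
    have : m / (2*y) < m / (2*x) :=
      div_lt_div_of_pos_left hm (by linarith [hx.1]) (by linarith)
    linarith
  have hgauss : Integrable fun s : ℝ => exp (-t * s ^ 2) := integrable_exp_neg_mul_sq ht
  have himg : (fun r : ℝ => r - m / (2*r)) '' S ⊆ Set.Iic 0 := by
    rintro _ ⟨r, hr, rfl⟩
    have h1 := hsq r hr
    have : r ≤ m / (2*r) := by
      rw [le_div_iff₀ (by linarith [hr.1])]
      nlinarith
    simp only [Set.mem_Iic]
    linarith
  have hhalf : ∫ s in Set.Iic (0:ℝ), exp (-t * s ^ 2) = √(π / t) / 2 := by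
    rw [← integral_gaussian_Ioi t]
    have h := integral_comp_neg_Iic (0:ℝ) (fun s => exp (-t * s ^ 2))
    rw [neg_zero] at h
    rw [← h]
    refine setIntegral_congr_fun measurableSet_Iic fun s _ => ?_
    simp only [neg_sq]
  have hcov := integral_image_eq_integral_abs_deriv_smul measurableSet_Ioo hder hinj
    (fun s => exp (-t * s ^ 2))
  have hint := (integrableOn_image_iff_integrableOn_abs_deriv_smul measurableSet_Ioo hder hinj
    (fun s => exp (-t * s ^ 2))).1 hgauss.integrableOn
  have hle : ∫ s in (fun r : ℝ => r - m / (2*r)) '' S, exp (-t * s ^ 2) ≤ √(π / t) / 2 := by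
    rw [← hhalf]
    exact setIntegral_mono_set hgauss.integrableOn
      (Filter.Eventually.of_forall fun s => (exp_pos _).le) himg.eventuallyLE
  have hconst : (2 : ℝ) ^ (-1 - a) * (2*m) ^ (a/2) = √(m/2) ^ a / 2 := by
    have h4 : (2*m) ^ (a/2) = (2:ℝ) ^ a * √(m/2) ^ a := by
      rw [← mul_rpow (by norm_num) (sqrt_nonneg _), show 2 * m = (2 * √(m/2)) ^ (2:ℝ) by
        rw [rpow_two, mul_pow, sq_sqrt (by positivity)]; ring, ← rpow_mul (by positivity)]
      congr 1
      ring
    rw [h4, ← mul_assoc, ← rpow_add two_pos, show -1 - a + a = -1 by ring, rpow_neg_one]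
    ring
  have hsqrt : √π / 2 * t ^ (-(1 : ℝ)/2) = √(π / t) / 2 := by
    rw [sqrt_div pi_pos.le, neg_div, rpow_neg ht.le, ← sqrt_eq_rpow]
    ring
  rw [hconst, mul_assoc, hsqrt]
  calc _ ≤ ∫ r in S, √(m/2) ^ a / 2 * (|1 + m / (2*r^2)| • exp (-t * (r - m / (2*r)) ^ 2)) := by
        refine integral_mono_of_nonneg ?_ (hint.const_mul _) ?_
        · filter_upwards [ae_restrict_mem measurableSet_Ioo] with r hr
          exact mul_nonneg (rpow_nonneg hr.1.le _) (exp_pos _).le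
        · filter_upwards [ae_restrict_mem measurableSet_Ioo] with r hr
          have hr2 : 0 < r ^ 2 := pow_pos hr.1 2
          have h1 : 1 ≤ m / (2*r^2) := by
            rw [le_div_iff₀ (by positivity)]
            linarith [hsq r hr]
          have h2 : r ^ a ≤ √(m/2) ^ a := rpow_le_rpow hr.1.le hr.2.le ha.le
          have h3 : 0 ≤ √(m/2) ^ a := by positivity
          rw [smul_eq_mul, abs_of_nonneg (by linarith), ← mul_assoc]
          refine mul_le_mul_of_nonneg_right ?_ (exp_pos _).le
          nlinarith
    _ = √(m/2) ^ a / 2 * ∫ s in (fun r : ℝ => r - m / (2*r)) '' S, exp (-t * s ^ 2) := by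
        rw [integral_const_mul, hcov]
    _ ≤ _ := mul_le_mul_of_nonneg_left hle (by positivity)
end

section
/- For every real a > 0 there exists a constant C(a) > 0 such that for every m > 0 and every t > 0, ∫_{√(m/2)}^∞ r^a e^{-t(r - m/(2r))²} dr ≤ C(a) (t^{-(1+a)/2} + m^{a/2} t^{-1/2}). -/
open Real MeasureTheory

lemma rpow_le_two_rpow_mul_sub_rpow_add {a b r : ℝ} (ha : 0 ≤ a) (hb : 0 ≤ b) (hr : b ≤ r) :
    r ^ a ≤ 2 ^ a * ((r - b) ^ a + b ^ a) := by
  have hu : 0 ≤ r - b := sub_nonneg.2 hr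
  rw [mul_add, ← mul_rpow zero_le_two hu, ← mul_rpow zero_le_two hb]
  rcases le_total (r - b) b with h | h
  · exact (rpow_le_rpow (hb.trans hr) (by linarith) ha).trans
      (le_add_of_nonneg_left (by positivity))
  · exact (rpow_le_rpow (hb.trans hr) (by linarith) ha).trans
      (le_add_of_nonneg_right (by positivity))

lemma sub_sq_le_sub_sq_div_sq {b r : ℝ} (hb : 0 < b) (hr : b ≤ r) :
    (r - b) ^ 2 ≤ (r - b ^ 2 / r) ^ 2 := by
  have hr0 : 0 < r := hb.trans_le hr
  have h : b ^ 2 / r ≤ b := by rw [div_le_iff₀ hr0]; nlinarith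
  exact pow_le_pow_left₀ (sub_nonneg.2 hr) (by linarith) 2

lemma integral_Ioi_rpow_mul_exp_neg_mul_sq {t q : ℝ} (hq : -1 < q) (ht : 0 < t) :
    ∫ u in Set.Ioi (0 : ℝ), u ^ q * exp (-t * u ^ 2) =
      t ^ (-(q + 1) / 2) * (1 / 2) * Gamma ((q + 1) / 2) := by
  simpa only [rpow_two] using integral_rpow_mul_exp_neg_mul_rpow two_pos hq ht

/-- Second half of the proof of Lemma 2.3: for every `a > 0` there is `C(a) > 0`
such that for all `m > 0` and `t > 0`,
`∫_{√(m/2)}^∞ r^a e^{-t(r-m/(2r))²} dr ≤ C(a)(t^{-(1+a)/2} + m^{a/2} t^{-1/2})`. -/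
theorem integral_rpow_exp_shifted_upper_part (a : ℝ) (ha : 0 < a) :
    ∃ C > (0 : ℝ), ∀ m : ℝ, 0 < m → ∀ t : ℝ, 0 < t →
      (∫ r in Set.Ioi (Real.sqrt (m/2)), r ^ a * Real.exp (-t * (r - m / (2*r))^2))
        ≤ C * (t ^ (-(1 + a)/2) + m ^ (a/2) * t ^ (-(1 : ℝ)/2)) := by
  have hG : 0 < Gamma ((a + 1) / 2) := Gamma_pos_of_pos (by positivity)
  have hG0 : 0 < Gamma ((0 + 1) / 2) := Gamma_pos_of_pos (by norm_num)
  refine ⟨2 ^ a * (Gamma ((a + 1) / 2) + Gamma ((0 + 1) / 2)), by positivity, fun m hm t ht ↦ ?_⟩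
  set b := √(m / 2) with hb_def
  have hb : 0 < b := sqrt_pos.2 (by positivity)
  have hb2 : b ^ 2 = m / 2 := sq_sqrt (by positivity)
  have hba : b ^ a ≤ m ^ (a / 2) := by
    rw [hb_def, sqrt_eq_rpow, ← rpow_mul (by positivity), one_div_mul_eq_div]
    exact rpow_le_rpow (by positivity) (by linarith) (by positivity)
  let g : ℝ → ℝ := fun u ↦
    2 ^ a * (u ^ a * exp (-t * u ^ 2) + b ^ a * (u ^ (0 : ℝ) * exp (-t * u ^ 2)))
  have hi1 := integrableOn_rpow_mul_exp_neg_mul_sq ht (by linarith : -1 < a)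
  have hi2 := (integrableOn_rpow_mul_exp_neg_mul_sq ht (by norm_num : (-1 : ℝ) < 0)).const_mul
    (b ^ a)
  have hg : IntegrableOn g (Set.Ioi 0) := (hi1.add hi2).const_mul (2 ^ a)
  have hmp := measurePreserving_sub_right (volume : Measure ℝ) b
  have hme := measurableEmbedding_subRight b
  have hpre : (fun x ↦ x - b) ⁻¹' Set.Ioi 0 = Set.Ioi b := by simp
  have hgb : IntegrableOn (fun r ↦ g (r - b)) (Set.Ioi b) := by
    rw [← hpre]
    exact (hmp.integrableOn_comp_preimage hme).2 hg
  have hshift : ∫ r in Set.Ioi b, g (r - b) = ∫ u in Set.Ioi 0, g u := by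
    rw [← hpre]
    exact hmp.setIntegral_preimage_emb hme g _
  have hval : ∫ u in Set.Ioi 0, g u = 2 ^ a * (t ^ (-(a + 1) / 2) * (1 / 2) * Gamma ((a + 1) / 2) +
      b ^ a * (t ^ (-(0 + 1 : ℝ) / 2) * (1 / 2) * Gamma ((0 + 1) / 2))) := by
    rw [integral_const_mul, integral_add hi1 hi2, integral_const_mul,
      integral_Ioi_rpow_mul_exp_neg_mul_sq (by linarith) ht,
      integral_Ioi_rpow_mul_exp_neg_mul_sq (by norm_num) ht]
  have hle : ∫ r in Set.Ioi b, r ^ a * exp (-t * (r - m / (2 * r)) ^ 2) ≤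
      ∫ r in Set.Ioi b, g (r - b) := by
    refine integral_mono_of_nonneg ?_ hgb ?_ <;>
      filter_upwards [ae_restrict_mem measurableSet_Ioi] with r hr
    · have : 0 < r := hb.trans hr
      simp only [Pi.zero_apply]
      positivity
    · have hbr : b ≤ r := le_of_lt hr
      have hsq := sub_sq_le_sub_sq_div_sq hb hbr
      rw [hb2, div_div] at hsq
      calc r ^ a * exp (-t * (r - m / (2 * r)) ^ 2)
          ≤ (2 ^ a * ((r - b) ^ a + b ^ a)) * exp (-t * (r - b) ^ 2) := by
            refine mul_le_mul (rpow_le_two_rpow_mul_sub_rpow_add ha.le hb.le hbr)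
              (exp_le_exp.2 (by nlinarith)) (exp_pos _).le ?_
            have := sub_nonneg.2 hbr
            positivity
        _ = g (r - b) := by simp only [g, rpow_zero]; ring
  rw [hshift, hval, zero_add, add_comm a 1] at hle
  rw [zero_add, add_comm a 1]
  rw [zero_add] at hG0
  rw [add_comm a 1] at hG
  refine hle.trans ?_
  rw [mul_assoc (2 ^ a) (_ + _)]
  refine mul_le_mul_of_nonneg_left ?_ (by positivity)
  have hT : 0 < t ^ (-(1 + a) / 2) := by positivity
  have hS : 0 < t ^ (-(1 : ℝ) / 2) := by positivity
  have hbS := mul_le_mul_of_nonneg_right hba hS.le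
  have hbS0 : 0 < b ^ a * t ^ (-(1 : ℝ) / 2) := by positivity
  nlinarith [mul_pos hT hG, mul_pos hT hG0, mul_pos hbS0 hG0,
    mul_le_mul_of_nonneg_right hbS hG0.le, mul_le_mul_of_nonneg_right hbS hG.le,
    mul_pos hbS0 hG]
end

section
/- For every m > 0 there exists a constant C > 0 (depending on m) such that for all t > 0, t ∫₀^∞ s^{-5/2} e^{-(t/(2√s) - m√s)²} ds ≤ C (t^{-1} + t^{-2}). -/
open Real MeasureTheory

/-- Completing the square at the saddle point `u = √(m / a)` dominates the subordination density
in the variable `u = s ^ (-1/2)` by a Gaussian. -/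
lemma sq_mul_exp_neg_sq_sub_div_le {a m u : ℝ} (ha : 0 < a) (hm : 0 < m) (hu : 0 < u) :
    u ^ 2 * Real.exp (-(a * u - m / u) ^ 2) ≤
      (4 / a ^ 2 + 2 * m / a) * Real.exp (-(a ^ 2 / 2) * (u - Real.sqrt (m / a)) ^ 2) := by
  set c := Real.sqrt (m / a) with hc
  have hc0 : 0 ≤ c := Real.sqrt_nonneg _
  have hc2 : c ^ 2 = m / a := Real.sq_sqrt (by positivity)
  have hmc : m = a * c ^ 2 := by rw [hc2]; field_simp
  have hfac : a * u - m / u = a * (u - c) * (1 + c / u) := by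
    rw [hmc]; field_simp; ring
  have hexp : a ^ 2 * (u - c) ^ 2 ≤ (a * u - m / u) ^ 2 := by
    rw [hfac, mul_pow, mul_pow]
    exact le_mul_of_one_le_right (by positivity)
      (one_le_pow₀ (le_add_of_nonneg_right (by positivity)))
  set x := a ^ 2 / 2 * (u - c) ^ 2 with hx
  have hx0 : 0 ≤ x := by positivity
  have hux : u ^ 2 ≤ 4 / a ^ 2 * x + 2 * m / a := by
    have h1 : 4 / a ^ 2 * x = 2 * (u - c) ^ 2 := by rw [hx]; field_simp; ring
    have h2 : 2 * m / a = 2 * c ^ 2 := by rw [hc2]; ring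
    rw [h1, h2]
    nlinarith [sq_nonneg (u - 2 * c)]
  have hpoly : u ^ 2 ≤ (4 / a ^ 2 + 2 * m / a) * Real.exp x := by
    have h3 : x ≤ Real.exp x := by linarith [Real.add_one_le_exp x]
    have h4 : 1 ≤ Real.exp x := Real.one_le_exp hx0
    calc u ^ 2 ≤ 4 / a ^ 2 * x + 2 * m / a * 1 := by simpa using hux
      _ ≤ 4 / a ^ 2 * Real.exp x + 2 * m / a * Real.exp x := by gcongr
      _ = _ := by ring
  calc u ^ 2 * Real.exp (-(a * u - m / u) ^ 2)
      ≤ ((4 / a ^ 2 + 2 * m / a) * Real.exp x) * Real.exp (-(2 * x)) := by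
        gcongr
        rw [hx]; linarith
    _ = (4 / a ^ 2 + 2 * m / a) * Real.exp (-(a ^ 2 / 2) * (u - c) ^ 2) := by
        rw [mul_assoc, ← Real.exp_add]
        congr 2
        rw [hx]; ring

lemma integral_sq_mul_exp_neg_sq_sub_div_le {a m : ℝ} (ha : 0 < a) (hm : 0 < m) :
    ∫ u in Set.Ioi (0 : ℝ), u ^ 2 * Real.exp (-(a * u - m / u) ^ 2) ≤
      (4 / a ^ 2 + 2 * m / a) * (Real.sqrt (2 * π) / a) := by
  set c := Real.sqrt (m / a)
  have hint : Integrable fun u : ℝ =>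
      (4 / a ^ 2 + 2 * m / a) * Real.exp (-(a ^ 2 / 2) * (u - c) ^ 2) :=
    ((integrable_exp_neg_mul_sq (by positivity : 0 < a ^ 2 / 2)).comp_sub_right c).const_mul _
  calc _ ≤ ∫ u in Set.Ioi (0 : ℝ),
          (4 / a ^ 2 + 2 * m / a) * Real.exp (-(a ^ 2 / 2) * (u - c) ^ 2) := by
        refine integral_mono_of_nonneg (.of_forall fun u => by positivity) hint.integrableOn ?_
        filter_upwards [ae_restrict_mem measurableSet_Ioi] with u hu
        exact sq_mul_exp_neg_sq_sub_div_le ha hm hu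
    _ ≤ ∫ u : ℝ, (4 / a ^ 2 + 2 * m / a) * Real.exp (-(a ^ 2 / 2) * (u - c) ^ 2) :=
        setIntegral_le_integral hint (.of_forall fun u => by positivity)
    _ = (4 / a ^ 2 + 2 * m / a) * (Real.sqrt (2 * π) / a) := by
        rw [integral_const_mul,
          integral_sub_right_eq_self (fun u : ℝ => Real.exp (-(a ^ 2 / 2) * u ^ 2)) c,
          integral_gaussian]
        congr 1
        rw [show π / (a ^ 2 / 2) = 2 * π / a ^ 2 by field_simp, Real.sqrt_div (by positivity),
          Real.sqrt_sq ha.le]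

/-- The substitution `u = s ^ (-1/2)` in the subordination integral. -/
lemma integral_rpow_mul_exp_neg_sq_eq (m t : ℝ) :
    ∫ s in Set.Ioi (0 : ℝ),
        s ^ (-(5 : ℝ)/2) * Real.exp (-(t / (2 * Real.sqrt s) - m * Real.sqrt s)^2) =
      2 * ∫ u in Set.Ioi (0 : ℝ), u ^ 2 * Real.exp (-(t / 2 * u - m / u) ^ 2) := by
  rw [← integral_const_mul, ← integral_comp_rpow_Ioi
    (fun u : ℝ => 2 * (u ^ 2 * Real.exp (-(t / 2 * u - m / u) ^ 2)))
    (by norm_num : (-(1 / 2) : ℝ) ≠ 0)]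
  refine setIntegral_congr_fun measurableSet_Ioi fun s (hs : 0 < s) => ?_
  have h1 : s ^ (-(1 / 2) : ℝ) = (Real.sqrt s)⁻¹ := by
    rw [Real.rpow_neg hs.le, Real.sqrt_eq_rpow]
  have h2 : s ^ (-(5 : ℝ) / 2) = s ^ (-(1 / 2) - 1 : ℝ) * (s ^ (-(1 / 2) : ℝ)) ^ 2 := by
    rw [← Real.rpow_natCast, ← Real.rpow_mul hs.le, ← Real.rpow_add hs]
    norm_num
  have h3 : t / (2 * Real.sqrt s) - m * Real.sqrt s =
      t / 2 * (Real.sqrt s)⁻¹ - m / (Real.sqrt s)⁻¹ := by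
    rw [div_inv_eq_mul]; ring
  have h4 : |(-(1 / 2) : ℝ)| = 1 / 2 := by norm_num [abs_of_pos]
  simp only [smul_eq_mul]
  rw [h2, h4, h3, h1]
  ring

/-- Estimate (2.23): for every `m > 0` there is `C > 0` such that for all `t > 0`,
`t ∫₀^∞ s^{-5/2} e^{-(t/(2√s)-m√s)²} ds ≤ C (t^{-1} + t^{-2})`. -/
theorem massive_subordination_bound (m : ℝ) (hm : 0 < m) :
    ∃ C > (0 : ℝ), ∀ t : ℝ, 0 < t →
      t * (∫ s in Set.Ioi (0 : ℝ),
          s ^ (-(5 : ℝ)/2) * Real.exp (-(t / (2 * Real.sqrt s) - m * Real.sqrt s)^2))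
        ≤ C * (t ^ (-(1 : ℝ)) + t ^ (-(2 : ℝ))) := by
  refine ⟨4 * Real.sqrt (2 * π) * (16 + 4 * m), by positivity, fun t ht => ?_⟩
  have h1 : t ^ (-(1 : ℝ)) = 1 / t := by rw [Real.rpow_neg_one, one_div]
  have h2 : t ^ (-(2 : ℝ)) = 1 / t ^ 2 := by
    rw [Real.rpow_neg ht.le, Real.rpow_two, one_div]
  rw [integral_rpow_mul_exp_neg_sq_eq, h1, h2]
  calc _ ≤ t * (2 * ((4 / (t / 2) ^ 2 + 2 * m / (t / 2)) * (Real.sqrt (2 * π) / (t / 2)))) := by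
        gcongr
        exact integral_sq_mul_exp_neg_sq_sub_div_le (half_pos ht) hm
    _ = 4 * Real.sqrt (2 * π) * (4 * m * (1 / t) + 16 * (1 / t ^ 2)) := by
        field_simp; ring
    _ ≤ 4 * Real.sqrt (2 * π) * ((16 + 4 * m) * (1 / t) + (16 + 4 * m) * (1 / t ^ 2)) := by
        gcongr <;> linarith
    _ = _ := by ring
end

section
/- For every m > 0 and every κ ∈ (0, 1/2] there exists a constant C > 0 such that for all t ≥ 1, t ∫₀^∞ s^{-5/2 - κ} e^{-(t/(2√s) - m√s)²} ds ≤ C t^{-1-κ}. -/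
open Real MeasureTheory

/-- Powers are dominated by exponentials: `x ^ q ≤ (q / a) ^ q * exp (a * x)`. -/
lemma rpow_le_div_rpow_mul_exp {a q x : ℝ} (ha : 0 < a) (hq : 0 < q) (hx : 0 ≤ x) :
    x ^ q ≤ (q / a) ^ q * Real.exp (a * x) := by
  have h : x ≤ q / a * Real.exp (a / q * x) := by
    have h1 : a / q * x ≤ Real.exp (a / q * x) := by
      linarith [Real.add_one_le_exp (a / q * x)]
    calc x = q / a * (a / q * x) := by field_simp
      _ ≤ _ := by gcongr
  calc x ^ q ≤ (q / a * Real.exp (a / q * x)) ^ q := by gcongr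
    _ = (q / a) ^ q * Real.exp (a * x) := by
      rw [Real.mul_rpow (by positivity) (by positivity), ← Real.exp_mul]
      congr 2
      field_simp

/-- Change of variables for a Gaussian along an injective differentiable map:
the transported integrand is integrable, with integral at most that over the whole line. -/
lemma integral_abs_deriv_mul_gaussian_le {f f' : ℝ → ℝ} {S : Set ℝ} (hS : MeasurableSet S)
    (hf' : ∀ x ∈ S, HasDerivWithinAt f (f' x) S x) (hf : Set.InjOn f S) {b : ℝ} (hb : 0 < b) :
    IntegrableOn (fun x => |f' x| * Real.exp (-b * f x ^ 2)) S ∧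
      ∫ x in S, |f' x| * Real.exp (-b * f x ^ 2) ≤ √(π / b) := by
  have hg := integrable_exp_neg_mul_sq hb
  refine ⟨(integrableOn_image_iff_integrableOn_abs_deriv_smul hS hf' hf
    (fun u => Real.exp (-b * u ^ 2))).1 hg.integrableOn, ?_⟩
  have h := integral_image_eq_integral_abs_deriv_smul hS hf' hf (fun u => Real.exp (-b * u ^ 2))
  simp only [smul_eq_mul] at h
  rw [← h, ← integral_gaussian b]
  exact setIntegral_le_integral hg (Filter.Eventually.of_forall fun u => (Real.exp_pos _).le)

/-- The phase `s ↦ t / (2√s) - m√s` has the expected derivative. -/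
lemma hasDerivAt_phase (m t : ℝ) {s : ℝ} (hs : 0 < s) :
    HasDerivAt (fun s => t / (2 * √s) - m * √s) (-(t / (4 * √s ^ 3) + m / (2 * √s))) s := by
  have hr : 0 < √s := Real.sqrt_pos.2 hs
  have h := Real.hasDerivAt_sqrt hs.ne'
  refine (((hasDerivAt_const s t).div (h.const_mul 2) (by positivity)).sub
    (h.const_mul m)).congr_deriv ?_
  rw [zero_mul, zero_sub]
  field_simp
  ring

/-- The phase `s ↦ t / (2√s) - m√s` is injective on the positive half-line. -/
lemma injOn_phase {m t : ℝ} (hm : 0 < m) (ht : 0 < t) :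
    Set.InjOn (fun s => t / (2 * √s) - m * √s) (Set.Ioi 0) := by
  refine StrictAntiOn.injOn fun a ha b _ hab => ?_
  have ha' : 0 < √a := Real.sqrt_pos.2 ha
  have hlt : √a < √b := Real.sqrt_lt_sqrt (le_of_lt ha) hab
  have h1 : t / (2 * √b) < t / (2 * √a) := by gcongr
  have h2 : m * √a < m * √b := by gcongr
  show t / (2 * √b) - m * √b < t / (2 * √a) - m * √a
  linarith

/-- Half of the Gaussian factor turns a power of `s` into the same power of `t`. -/
lemma rpow_neg_mul_exp_phase_le {m t s q : ℝ} (ht : 1 ≤ t) (hs : 0 < s) (hq : 0 < q) :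
    s ^ (-q) * Real.exp (-(1 / 2) * (t / (2 * √s) - m * √s) ^ 2) ≤
      (q / (1 / 8)) ^ q * Real.exp (m / 2) * t ^ (-q) := by
  have ht0 : 0 < t := by linarith
  have hr : 0 < √s := Real.sqrt_pos.2 hs
  have hsq : √s ^ 2 = s := Real.sq_sqrt hs.le
  have hphase : 1 / 8 * (t / s) - m / 2 ≤ 1 / 2 * (t / (2 * √s) - m * √s) ^ 2 := by
    have h1 : 1 / 2 * (t / (2 * √s) - m * √s) ^ 2 = (t - 2 * m * s) ^ 2 / (8 * s) := by
      have h2 : t / (2 * √s) - m * √s = (t - 2 * m * s) / (2 * √s) := by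
        field_simp
        rw [hsq]
        ring
      rw [h2, div_pow, mul_pow, hsq]
      field_simp
      ring
    have h3 : 1 / 8 * (t / s) - m / 2 = (t - 4 * m * s) / (8 * s) := by
      field_simp
      ring
    rw [h1, h3]
    gcongr
    by_cases h : t - 4 * m * s ≤ 0
    · exact h.trans (sq_nonneg _)
    · push Not at h
      nlinarith [sq_nonneg (m * s), mul_nonneg (sub_nonneg.2 ht) h.le]
  have hpow := rpow_le_div_rpow_mul_exp (a := 1 / 8) (by norm_num) hq (div_pos ht0 hs).le
  have hsplit : s ^ (-q) = (t / s) ^ q * t ^ (-q) := by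
    rw [Real.div_rpow ht0.le hs.le, Real.rpow_neg hs.le, Real.rpow_neg ht0.le]
    have := Real.rpow_pos_of_pos ht0 q
    field_simp
  calc s ^ (-q) * Real.exp (-(1 / 2) * (t / (2 * √s) - m * √s) ^ 2)
      ≤ ((q / (1 / 8)) ^ q * Real.exp (1 / 8 * (t / s)) * t ^ (-q)) *
          Real.exp (m / 2 - 1 / 8 * (t / s)) := by
        rw [hsplit]
        gcongr
        linarith
    _ = _ := by
        rw [Real.exp_sub]
        field_simp

/-- For `m > 0` and `κ ∈ (0,1/2]` there is `C > 0` such that for all `t ≥ 1`,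
`t ∫₀^∞ s^{-5/2-κ} e^{-(t/(2√s)-m√s)²} ds ≤ C t^{-1-κ}`. -/
theorem massive_subordination_bound_nonint_flux (m κ : ℝ) (hm : 0 < m)
    (hκ : κ ∈ Set.Ioc (0 : ℝ) (1/2)) :
    ∃ C > (0 : ℝ), ∀ t : ℝ, 1 ≤ t →
      t * (∫ s in Set.Ioi (0 : ℝ),
          s ^ (-(5 : ℝ)/2 - κ) * Real.exp (-(t / (2 * Real.sqrt s) - m * Real.sqrt s)^2))
        ≤ C * t ^ (-1 - κ) := by
  have hq : 0 < 1 + κ := by linarith [hκ.1]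
  set K : ℝ := ((1 + κ) / (1 / 8)) ^ (1 + κ) * Real.exp (m / 2) with hK
  have hKpos : 0 < K := by positivity
  refine ⟨K * 4 * √(π / (1 / 2)), by positivity, fun t ht => ?_⟩
  have ht0 : 0 < t := by linarith
  obtain ⟨hint, hle⟩ := integral_abs_deriv_mul_gaussian_le measurableSet_Ioi
    (fun s (hs : s ∈ Set.Ioi (0 : ℝ)) => (hasDerivAt_phase m t hs).hasDerivWithinAt)
    (injOn_phase hm ht0) (b := 1 / 2) (by norm_num)
  have hmono : ∫ s in Set.Ioi (0 : ℝ),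
      s ^ (-(5 : ℝ)/2 - κ) * Real.exp (-(t / (2 * √s) - m * √s)^2) ≤
      ∫ s in Set.Ioi (0 : ℝ), K * t ^ (-(1 + κ)) * (4 / t) *
        (|-(t / (4 * √s ^ 3) + m / (2 * √s))| *
          Real.exp (-(1 / 2) * (t / (2 * √s) - m * √s) ^ 2)) := by
    refine integral_mono_of_nonneg ?_ (hint.const_mul _) ?_
    · filter_upwards [ae_restrict_mem measurableSet_Ioi] with s hs
      have hs' : (0 : ℝ) < s := hs
      simp only [Pi.zero_apply]
      positivity
    · filter_upwards [ae_restrict_mem measurableSet_Ioi] with s hs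
      have hs' : (0 : ℝ) < s := hs
      have hr : 0 < √s := Real.sqrt_pos.2 hs'
      have hpow : s ^ (-(3 : ℝ) / 2) ≤ 4 / t * |-(t / (4 * √s ^ 3) + m / (2 * √s))| := by
        have h1 : s ^ (-(3 : ℝ) / 2) = 4 / t * (t / (4 * √s ^ 3)) := by
          have h2 : s ^ (-(3 : ℝ) / 2) = (√s ^ 3)⁻¹ := by
            rw [Real.sqrt_eq_rpow, ← Real.rpow_natCast, ← Real.rpow_mul hs'.le,
              ← Real.rpow_neg hs'.le]
            norm_num
          rw [h2]
          field_simp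
        rw [h1, abs_neg, abs_of_pos (by positivity)]
        gcongr
        exact le_add_of_nonneg_right (by positivity)
      have hE : Real.exp (-(t / (2 * √s) - m * √s)^2) =
          Real.exp (-(1 / 2) * (t / (2 * √s) - m * √s) ^ 2) *
            Real.exp (-(1 / 2) * (t / (2 * √s) - m * √s) ^ 2) := by
        rw [← Real.exp_add]
        ring_nf
      have hS : s ^ (-(5 : ℝ)/2 - κ) = s ^ (-(1 + κ)) * s ^ (-(3 : ℝ) / 2) := by
        rw [← Real.rpow_add hs']
        ring_nf
      have hhalf := rpow_neg_mul_exp_phase_le (m := m) ht hs' hq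
      rw [← hK] at hhalf
      calc s ^ (-(5 : ℝ)/2 - κ) * Real.exp (-(t / (2 * √s) - m * √s)^2)
          = (s ^ (-(1 + κ)) * Real.exp (-(1 / 2) * (t / (2 * √s) - m * √s) ^ 2)) *
            (s ^ (-(3 : ℝ) / 2) * Real.exp (-(1 / 2) * (t / (2 * √s) - m * √s) ^ 2)) := by
            rw [hE, hS]
            ring
        _ ≤ (K * t ^ (-(1 + κ))) * (4 / t * |-(t / (4 * √s ^ 3) + m / (2 * √s))| *
            Real.exp (-(1 / 2) * (t / (2 * √s) - m * √s) ^ 2)) := by gcongr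
        _ = _ := by ring
  rw [integral_const_mul] at hmono
  have hexp : -(1 + κ) = -1 - κ := by ring
  rw [hexp] at hmono
  calc t * _ ≤ t * (K * t ^ (-1 - κ) * (4 / t) * √(π / (1 / 2))) := by
        gcongr
        exact hmono.trans (by gcongr)
    _ = K * 4 * √(π / (1 / 2)) * t ^ (-1 - κ) := by
        field_simp
end

section
/- For every m > 0 there exists a constant C > 0 such that for all t ≥ 1, t^{-1/2} ∫₀^∞ r² [log(2 + t/(4r²))]^{-2} e^{-t (r - m/(2r))²} dr ≤ C t^{-1} [log(2 + t)]^{-2}. -/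
open Real MeasureTheory

/-- Rescaling the argument of the logarithm by `s` costs at most a factor `1 + 2 * s`. -/
lemma log_two_add_le_mul_log_two_add_div {t s : ℝ} (ht : 0 ≤ t) (hs : 0 < s) :
    Real.log (2 + t) ≤ (1 + 2 * s) * Real.log (2 + t / s) := by
  have hts : 0 ≤ t / s := by positivity
  have hmul : 2 + t ≤ (2 + t / s) * (1 + s) := by
    have : t / s * s = t := by field_simp
    nlinarith
  have hlog : Real.log (2 + t) ≤ Real.log (2 + t / s) + Real.log (1 + s) := by
    rw [← Real.log_mul (by positivity) (by positivity)]
    exact Real.log_le_log (by positivity) hmul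
  have hlog_s : Real.log (1 + s) ≤ s := by
    linarith [Real.log_le_sub_one_of_pos (show 0 < 1 + s by positivity)]
  have hlog_half : 1 / 2 ≤ Real.log (2 + t / s) := by
    have : Real.log 2 ≤ Real.log (2 + t / s) := Real.log_le_log (by norm_num) (by linarith)
    linarith [Real.log_two_gt_d9]
  nlinarith

lemma log_two_add_div_rpow_neg_two_le {t s : ℝ} (ht : 0 ≤ t) (hs : 0 < s) :
    Real.log (2 + t / s) ^ (-(2 : ℝ)) ≤
      (1 + 2 * s) ^ 2 * Real.log (2 + t) ^ (-(2 : ℝ)) := by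
  have hts : 0 ≤ t / s := by positivity
  have hL : 0 < Real.log (2 + t) := Real.log_pos (by linarith)
  have hl : 0 < Real.log (2 + t / s) := Real.log_pos (by linarith)
  rw [Real.rpow_neg hl.le, Real.rpow_neg hL.le, Real.rpow_two, Real.rpow_two,
    ← div_eq_mul_inv, inv_eq_one_div, div_le_div_iff₀ (by positivity) (by positivity), one_mul,
    ← mul_pow]
  exact pow_le_pow_left₀ hL.le (log_two_add_le_mul_log_two_add_div ht hs) 2

lemma sq_sub_le_sq_sub_sq_div {a r : ℝ} (ha : 0 ≤ a) (hr : 0 < r) :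
    (r - a) ^ 2 ≤ (r - a ^ 2 / r) ^ 2 := by
  have h : r - a ^ 2 / r = (r - a) * (1 + a / r) := by field_simp; ring
  have har : 0 ≤ a / r := by positivity
  rw [h, mul_pow]
  exact le_mul_of_one_le_right (sq_nonneg _) (by nlinarith)

lemma sq_mul_one_add_sq_le_exp (a r : ℝ) :
    r ^ 2 * (1 + 8 * r ^ 2) ^ 2 ≤
      (6 * (16 + 16 * a ^ 2)) ^ 3 * Real.exp ((r - a) ^ 2 / 2) := by
  set c := 16 + 16 * a ^ 2 with hc
  set w := c * (1 + (r - a) ^ 2) with hw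
  have hr : 1 + 8 * r ^ 2 ≤ w := by
    rw [hw, hc]
    nlinarith [sq_nonneg (r - 2 * a), mul_nonneg (sq_nonneg a) (sq_nonneg (r - a))]
  have hexp : w ≤ 6 * c * Real.exp ((r - a) ^ 2 / 6) := by
    have := Real.add_one_le_exp ((r - a) ^ 2 / 6)
    have hc0 : 0 ≤ c := by positivity
    rw [hw]
    nlinarith [sq_nonneg (r - a)]
  have hw0 : 0 ≤ w := by positivity
  calc r ^ 2 * (1 + 8 * r ^ 2) ^ 2 ≤ w * w ^ 2 := by
        gcongr
        nlinarith [sq_nonneg r]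
    _ = w ^ 3 := by ring
    _ ≤ (6 * c * Real.exp ((r - a) ^ 2 / 6)) ^ 3 := by gcongr
    _ = (6 * c) ^ 3 * Real.exp ((r - a) ^ 2 / 2) := by
        rw [mul_pow, ← Real.exp_nat_mul]
        congr 2
        push_cast
        ring

/-- For every `m > 0` there is `C > 0` such that for all `t ≥ 1`,
`t^{-1/2} ∫₀^∞ r² [log(2+t/(4r²))]^{-2} e^{-t(r-m/(2r))²} dr ≤ C t^{-1} [log(2+t)]^{-2}`. -/
theorem massive_subordination_bound_int_flux (m : ℝ) (hm : 0 < m) :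
    ∃ C > (0 : ℝ), ∀ t : ℝ, 1 ≤ t →
      t ^ (-(1 : ℝ)/2) * (∫ r in Set.Ioi (0 : ℝ),
          r ^ 2 * (Real.log (2 + t / (4 * r ^ 2))) ^ (-(2 : ℝ)) *
            Real.exp (-t * (r - m / (2*r))^2))
        ≤ C * t ^ (-(1 : ℝ)) * (Real.log (2 + t)) ^ (-(2 : ℝ)) := by
  obtain ⟨a, ha, rfl⟩ : ∃ a : ℝ, 0 ≤ a ∧ m = 2 * a ^ 2 :=
    ⟨√(m / 2), by positivity, by rw [Real.sq_sqrt (by positivity)]; ring⟩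
  set K := (6 * (16 + 16 * a ^ 2)) ^ 3 with hK
  have hK0 : 0 < K := by positivity
  refine ⟨K * √(2 * π), by positivity, fun t ht ↦ ?_⟩
  have ht0 : 0 < t := by linarith
  set L := Real.log (2 + t) ^ (-(2 : ℝ)) with hL
  have hL0 : 0 ≤ L := Real.rpow_nonneg (Real.log_nonneg (by linarith)) _
  let g : ℝ → ℝ := fun r ↦ K * L * Real.exp (-(t / 2) * (r - a) ^ 2)
  have hg : Integrable g :=
    ((integrable_exp_neg_mul_sq (half_pos ht0)).comp_sub_right a).const_mul (K * L)
  have hg_integral : ∫ r, g r = K * L * √(π / (t / 2)) := by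
    rw [integral_const_mul, integral_sub_right_eq_self (fun r ↦ Real.exp (-(t / 2) * r ^ 2)) a,
      integral_gaussian]
  have hlog_nonneg (r : ℝ) : 0 ≤ Real.log (2 + t / (4 * r ^ 2)) ^ (-(2 : ℝ)) := by
    have : 0 ≤ t / (4 * r ^ 2) := by positivity
    exact Real.rpow_nonneg (Real.log_nonneg (by linarith)) _
  have hbound : ∀ r ∈ Set.Ioi (0 : ℝ),
      r ^ 2 * (Real.log (2 + t / (4 * r ^ 2))) ^ (-(2 : ℝ)) *
        Real.exp (-t * (r - 2 * a ^ 2 / (2 * r)) ^ 2) ≤ g r := by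
    intro r hr
    have hr0 : 0 < r := hr
    have hphase : -t * (r - 2 * a ^ 2 / (2 * r)) ^ 2 ≤ -t * (r - a) ^ 2 := by
      rw [mul_div_mul_left _ _ two_ne_zero]
      nlinarith [sq_sub_le_sq_sub_sq_div ha hr0]
    have hlog := log_two_add_div_rpow_neg_two_le ht0.le (show 0 < 4 * r ^ 2 by positivity)
    calc _ ≤ r ^ 2 * ((1 + 2 * (4 * r ^ 2)) ^ 2 * L) * Real.exp (-t * (r - a) ^ 2) := by
          gcongr
      _ = L * (r ^ 2 * (1 + 8 * r ^ 2) ^ 2) * Real.exp (-t * (r - a) ^ 2) := by ring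
      _ ≤ L * (K * Real.exp ((r - a) ^ 2 / 2)) * Real.exp (-t * (r - a) ^ 2) := by
          exact mul_le_mul_of_nonneg_right
            (mul_le_mul_of_nonneg_left (sq_mul_one_add_sq_le_exp a r) hL0) (Real.exp_pos _).le
      _ = K * L * Real.exp ((r - a) ^ 2 / 2 + -t * (r - a) ^ 2) := by
          rw [Real.exp_add]; ring
      _ ≤ g r := by
          refine mul_le_mul_of_nonneg_left (Real.exp_le_exp.2 ?_) (by positivity)
          nlinarith [sq_nonneg (r - a)]
  have hint : (∫ r in Set.Ioi (0 : ℝ), r ^ 2 * (Real.log (2 + t / (4 * r ^ 2))) ^ (-(2 : ℝ)) *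
      Real.exp (-t * (r - 2 * a ^ 2 / (2 * r)) ^ 2)) ≤ K * L * √(π / (t / 2)) := by
    calc _ ≤ ∫ r in Set.Ioi (0 : ℝ), g r := by
          refine integral_mono_of_nonneg (.of_forall fun r ↦ ?_) hg.integrableOn
            ((ae_restrict_iff' measurableSet_Ioi).2 (.of_forall hbound))
          exact mul_nonneg (mul_nonneg (sq_nonneg r) (hlog_nonneg r)) (Real.exp_pos _).le
      _ ≤ ∫ r, g r := setIntegral_le_integral hg (.of_forall fun r ↦ by positivity)
      _ = _ := hg_integral
  have hsqrt : √(π / (t / 2)) = √(2 * π) * t ^ (-(1 : ℝ) / 2) := by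
    rw [show π / (t / 2) = 2 * π / t by field_simp, Real.sqrt_div (by positivity), neg_div,
      Real.rpow_neg ht0.le, ← Real.sqrt_eq_rpow, div_eq_mul_inv]
  have hpow : t ^ (-(1 : ℝ) / 2) * t ^ (-(1 : ℝ) / 2) = t ^ (-(1 : ℝ)) := by
    rw [← Real.rpow_add ht0]; norm_num
  calc _ ≤ t ^ (-(1 : ℝ) / 2) * (K * L * √(π / (t / 2))) := by gcongr
    _ = K * √(2 * π) * (t ^ (-(1 : ℝ) / 2) * t ^ (-(1 : ℝ) / 2)) * L := by rw [hsqrt]; ring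
    _ = _ := by rw [hpow]
end

section
/- There exists a constant C > 0 such that for all t ≥ 1, t ∫₀^∞ s^{-5/2} [log(2 + s)]^{-2} e^{-t²/(4s)} ds ≤ C t^{-2} [log(2 + t)]^{-2}. -/
open Real MeasureTheory

/-- The rescaled majorant `r ↦ r^{-5/2} (1 + r⁻²) e^{-1/(4r)}` of the subordination integrand. -/
noncomputable def subordinationMajorant (r : ℝ) : ℝ :=
  r ^ (-(5 : ℝ) / 2) * (1 + (r⁻¹) ^ 2) * Real.exp (-(r⁻¹ / 4))

lemma measurable_subordinationMajorant : Measurable subordinationMajorant := by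
  unfold subordinationMajorant
  fun_prop

lemma subordinationMajorant_nonneg {r : ℝ} (hr : 0 < r) : 0 ≤ subordinationMajorant r := by
  unfold subordinationMajorant
  positivity

lemma subordinationMajorant_le_of_le_one {r : ℝ} (hr : 0 < r) (hr1 : r ≤ 1) :
    subordinationMajorant r ≤ 245760 := by
  have hu : 1 ≤ r⁻¹ := (one_le_inv₀ hr).2 hr1
  have hpow : r ^ (-(5 : ℝ) / 2) ≤ (r⁻¹) ^ 3 := by
    rw [← Real.rpow_natCast, Real.inv_rpow hr.le, ← Real.rpow_neg hr.le]
    exact Real.rpow_le_rpow_of_exponent_ge hr hr1 (by norm_num)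
  have hsq : 1 + (r⁻¹) ^ 2 ≤ 2 * (r⁻¹) ^ 2 := by nlinarith
  have hexp := Real.pow_div_factorial_le_exp (r⁻¹ / 4) (by positivity) 5
  have hfac : ((Nat.factorial 5 : ℕ) : ℝ) = 120 := by norm_num [Nat.factorial]
  rw [hfac] at hexp
  unfold subordinationMajorant
  rw [Real.exp_neg, ← div_eq_mul_inv, div_le_iff₀ (Real.exp_pos _)]
  calc r ^ (-(5 : ℝ) / 2) * (1 + (r⁻¹) ^ 2) ≤ (r⁻¹) ^ 3 * (2 * (r⁻¹) ^ 2) := by gcongr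
    _ = 245760 * ((r⁻¹ / 4) ^ 5 / 120) := by ring
    _ ≤ 245760 * Real.exp (r⁻¹ / 4) := by gcongr

lemma subordinationMajorant_le_of_one_le {r : ℝ} (hr1 : 1 ≤ r) :
    subordinationMajorant r ≤ r ^ (-(5 : ℝ) / 2) * 2 := by
  have hr : 0 < r := by linarith
  have hu0 : 0 < r⁻¹ := inv_pos.2 hr
  have hu : r⁻¹ ≤ 1 := inv_le_one_of_one_le₀ hr1
  have hsq : 1 + (r⁻¹) ^ 2 ≤ 2 := by nlinarith
  have hexp : Real.exp (-(r⁻¹ / 4)) ≤ 1 := Real.exp_le_one_iff.2 (by linarith)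
  unfold subordinationMajorant
  calc r ^ (-(5 : ℝ) / 2) * (1 + (r⁻¹) ^ 2) * Real.exp (-(r⁻¹ / 4))
      ≤ r ^ (-(5 : ℝ) / 2) * 2 * 1 := by gcongr
    _ = _ := mul_one _

lemma integrableOn_subordinationMajorant :
    IntegrableOn subordinationMajorant (Set.Ioi 0) := by
  rw [← Set.Ioc_union_Ioi_eq_Ioi (zero_le_one (α := ℝ))]
  refine IntegrableOn.union ?_ ?_
  · refine Integrable.mono' (g := fun _ => (245760 : ℝ)) (by simp)
      measurable_subordinationMajorant.aestronglyMeasurable ?_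
    filter_upwards [ae_restrict_mem measurableSet_Ioc] with r hr
    rw [Real.norm_of_nonneg (subordinationMajorant_nonneg hr.1)]
    exact subordinationMajorant_le_of_le_one hr.1 hr.2
  · refine Integrable.mono'
      ((integrableOn_Ioi_rpow_of_lt (by norm_num : -(5 : ℝ) / 2 < -1) one_pos).mul_const 2)
      measurable_subordinationMajorant.aestronglyMeasurable ?_
    filter_upwards [ae_restrict_mem measurableSet_Ioi] with r hr
    have hr' : (1 : ℝ) < r := hr
    rw [Real.norm_of_nonneg (subordinationMajorant_nonneg (by linarith))]
    exact subordinationMajorant_le_of_one_le hr'.le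

/-- Replacing `s` by `t` in `[log (2 + s)]⁻²` costs at most a factor quadratic in `t² / s`. -/
lemma log_two_add_rpow_neg_two_le {s t : ℝ} (hs : 0 < s) (ht : 1 ≤ t) :
    Real.log (2 + s) ^ (-(2 : ℝ)) ≤
      16 * Real.log (2 + t) ^ (-(2 : ℝ)) * (1 + (t ^ 2 / s) ^ 2) := by
  have hlog2 : (1 / 2 : ℝ) < Real.log 2 := by linarith [Real.log_two_gt_d9]
  have hls : Real.log 2 ≤ Real.log (2 + s) := Real.log_le_log (by norm_num) (by linarith)
  have hlt : Real.log 2 ≤ Real.log (2 + t) := Real.log_le_log (by norm_num) (by linarith)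
  have hs0 : 0 < Real.log (2 + s) := by linarith
  have ht0 : 0 < Real.log (2 + t) := by linarith
  have key : Real.log (2 + t) ^ 2 ≤ 16 * (1 + (t ^ 2 / s) ^ 2) * Real.log (2 + s) ^ 2 := by
    rcases le_total t s with hts | hst
    · have h : Real.log (2 + t) ≤ Real.log (2 + s) :=
        Real.log_le_log (by linarith) (by linarith)
      calc Real.log (2 + t) ^ 2 ≤ 1 * Real.log (2 + s) ^ 2 := by rw [one_mul]; gcongr
        _ ≤ _ := by
          gcongr
          nlinarith [sq_nonneg (t ^ 2 / s)]
    · have h : Real.log (2 + t) ≤ 2 * t := by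
        linarith [Real.log_le_sub_one_of_pos (by linarith : 0 < 2 + t)]
      have hq : t ≤ t ^ 2 / s := by
        rw [le_div_iff₀ hs]
        nlinarith
      calc Real.log (2 + t) ^ 2 ≤ (2 * t) ^ 2 := by gcongr
        _ = 16 * t ^ 2 * (1 / 2) ^ 2 := by ring
        _ ≤ 16 * (1 + (t ^ 2 / s) ^ 2) * Real.log (2 + s) ^ 2 := by
          have h2 : t ^ 2 ≤ 1 + (t ^ 2 / s) ^ 2 := by
            have : t ^ 2 ≤ (t ^ 2 / s) ^ 2 := by gcongr
            linarith
          gcongr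
          linarith
  rw [Real.rpow_neg hs0.le, Real.rpow_neg ht0.le, Real.rpow_two, Real.rpow_two,
    inv_le_iff_one_le_mul₀ (by positivity)]
  have h1 : 1 ≤ (16 * (1 + (t ^ 2 / s) ^ 2) * Real.log (2 + s) ^ 2) / Real.log (2 + t) ^ 2 := by
    rwa [one_le_div₀ (by positivity)]
  calc 1 ≤ _ := h1
    _ = _ := by ring

lemma subordination_integrand_le {s t : ℝ} (hs : 0 < s) (ht : 1 ≤ t) :
    s ^ (-(5 : ℝ) / 2) * Real.log (2 + s) ^ (-(2 : ℝ)) * Real.exp (-t ^ 2 / (4 * s)) ≤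
      16 * Real.log (2 + t) ^ (-(2 : ℝ)) * (t ^ 5)⁻¹ *
        subordinationMajorant ((t ^ 2)⁻¹ * s) := by
  have ht0 : 0 < t := by linarith
  have hscale : ((t ^ 2)⁻¹ * s) ^ (-(5 : ℝ) / 2) = t ^ 5 * s ^ (-(5 : ℝ) / 2) := by
    rw [Real.mul_rpow (by positivity) hs.le, Real.inv_rpow (by positivity),
      ← Real.rpow_natCast t 2, ← Real.rpow_mul ht0.le, ← Real.rpow_neg ht0.le,
      ← Real.rpow_natCast t 5]
    norm_num
  have hinv : ((t ^ 2)⁻¹ * s)⁻¹ = t ^ 2 / s := by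
    rw [mul_inv, inv_inv, div_eq_mul_inv]
  have hexp : -(t ^ 2 / s / 4) = -t ^ 2 / (4 * s) := by
    field_simp
  unfold subordinationMajorant
  rw [hscale, hinv, hexp]
  calc _ ≤ s ^ (-(5 : ℝ) / 2) *
        (16 * Real.log (2 + t) ^ (-(2 : ℝ)) * (1 + (t ^ 2 / s) ^ 2)) *
          Real.exp (-t ^ 2 / (4 * s)) := by
        gcongr
        exact log_two_add_rpow_neg_two_le hs ht
    _ = _ := by
        field_simp

/-- Estimate (2.13): there is `C > 0` such that for all `t ≥ 1`,
`t ∫₀^∞ s^{-5/2} [log(2+s)]^{-2} e^{-t²/(4s)} ds ≤ C t^{-2} [log(2+t)]^{-2}`. -/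
theorem massless_subordination_bound_int_flux :
    ∃ C > (0 : ℝ), ∀ t : ℝ, 1 ≤ t →
      t * (∫ s in Set.Ioi (0 : ℝ),
          s ^ (-(5 : ℝ)/2) * (Real.log (2 + s)) ^ (-(2 : ℝ)) * Real.exp (-t^2 / (4*s)))
        ≤ C * t ^ (-(2 : ℝ)) * (Real.log (2 + t)) ^ (-(2 : ℝ)) := by
  have hI : 0 ≤ ∫ r in Set.Ioi (0 : ℝ), subordinationMajorant r :=
    setIntegral_nonneg measurableSet_Ioi fun r hr => subordinationMajorant_nonneg hr
  refine ⟨16 * (∫ r in Set.Ioi (0 : ℝ), subordinationMajorant r) + 1, by positivity,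
    fun t ht => ?_⟩
  have ht0 : 0 < t := by linarith
  have hb : 0 < (t ^ 2)⁻¹ := by positivity
  have hlog : 0 < Real.log (2 + t) := Real.log_pos (by linarith)
  have hint : IntegrableOn (fun s => subordinationMajorant ((t ^ 2)⁻¹ * s)) (Set.Ioi 0) := by
    rw [integrableOn_Ioi_comp_mul_left_iff _ _ hb, mul_zero]
    exact integrableOn_subordinationMajorant
  have hle : (∫ s in Set.Ioi (0 : ℝ),
      s ^ (-(5 : ℝ)/2) * (Real.log (2 + s)) ^ (-(2 : ℝ)) * Real.exp (-t^2 / (4*s))) ≤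
      ∫ s in Set.Ioi (0 : ℝ), 16 * Real.log (2 + t) ^ (-(2 : ℝ)) * (t ^ 5)⁻¹ *
        subordinationMajorant ((t ^ 2)⁻¹ * s) := by
    refine integral_mono_of_nonneg ?_ (hint.const_mul _) ?_
    · filter_upwards [ae_restrict_mem measurableSet_Ioi] with s hs
      have hs' : (0 : ℝ) < s := hs
      have : 0 < Real.log (2 + s) := Real.log_pos (by linarith)
      simp only [Pi.zero_apply]
      positivity
    · filter_upwards [ae_restrict_mem measurableSet_Ioi] with s hs
      exact subordination_integrand_le hs ht
  rw [integral_const_mul, integral_comp_mul_left_Ioi _ _ hb, mul_zero, inv_inv,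
    smul_eq_mul] at hle
  calc _ ≤ t * (16 * Real.log (2 + t) ^ (-(2 : ℝ)) * (t ^ 5)⁻¹ *
        (t ^ 2 * ∫ r in Set.Ioi (0 : ℝ), subordinationMajorant r)) := by gcongr
    _ = 16 * (∫ r in Set.Ioi (0 : ℝ), subordinationMajorant r) * t ^ (-(2 : ℝ)) *
        Real.log (2 + t) ^ (-(2 : ℝ)) := by
        rw [Real.rpow_neg ht0.le, Real.rpow_two]
        field_simp
    _ ≤ _ := by
        gcongr
        linarith
end

section
/- For all real numbers ν, ρ, w with 0 < ρ < ν and w > 0, one has (4w)^ν ∫₀^1 s^{ν - 1/2} (1-s)^{ν - 1/2} (1 + 4ws)^{-ν - 3/2} ds ≤ (4w)^ρ · Γ(ρ + 1/2) Γ(ν + 1/2) / Γ(ν + ρ + 1). -/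
open Real MeasureTheory intervalIntegral

/-- On `(0, 1)` the complex Beta integrand with real parameters is real. -/
lemma ofReal_beta_integrand (a b : ℝ) {x : ℝ} (hx : x ∈ Set.Ioo (0 : ℝ) 1) :
    (x : ℂ) ^ ((a : ℂ) - 1) * (1 - (x : ℂ)) ^ ((b : ℂ) - 1) =
      ((x ^ (a - 1) * (1 - x) ^ (b - 1) : ℝ) : ℂ) := by
  rw [Complex.ofReal_mul, Complex.ofReal_cpow hx.1.le,
    Complex.ofReal_cpow (sub_nonneg.mpr hx.2.le)]
  push_cast
  rfl

lemma integrableOn_beta_integrand {a b : ℝ} (ha : 0 < a) (hb : 0 < b) :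
    IntegrableOn (fun x : ℝ => x ^ (a - 1) * (1 - x) ^ (b - 1)) (Set.Ioo 0 1) := by
  have h := Complex.betaIntegral_convergent (u := a) (v := b) (by simpa) (by simpa)
  rw [intervalIntegrable_iff_integrableOn_Ioo_of_le zero_le_one] at h
  have h' := h.congr_fun (fun x hx => ofReal_beta_integrand a b hx) measurableSet_Ioo
  simpa [IntegrableOn] using h'.re

lemma setIntegral_beta_integrand {a b : ℝ} (ha : 0 < a) (hb : 0 < b) :
    ∫ x in Set.Ioo (0 : ℝ) 1, x ^ (a - 1) * (1 - x) ^ (b - 1) =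
      Real.Gamma a * Real.Gamma b / Real.Gamma (a + b) := by
  change _ = ProbabilityTheory.beta a b
  rw [ProbabilityTheory.beta_eq_betaIntegralReal a b ha hb, Complex.betaIntegral,
    intervalIntegral.integral_of_le zero_le_one, integral_Ioc_eq_integral_Ioo,
    setIntegral_congr_fun measurableSet_Ioo (fun x hx => ofReal_beta_integrand a b hx),
    integral_complex_ofReal, Complex.ofReal_re]

lemma one_add_rpow_le_rpow {x p q : ℝ} (hx : 0 < x) (hpq : p ≤ q) (hq : q ≤ 0) :
    (1 + x) ^ p ≤ x ^ q :=
  (rpow_le_rpow_of_exponent_le (by linarith) hpq).trans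
    (rpow_le_rpow_of_nonpos hx (by linarith) hq)

/-- Core estimate in Lemma 3.1 (case `ν > 3/2`): for `0 < ρ < ν` and `w > 0`,
`(4w)^ν ∫₀^1 s^{ν-1/2}(1-s)^{ν-1/2}(1+4ws)^{-ν-3/2} ds
  ≤ (4w)^ρ Γ(ρ+1/2)Γ(ν+1/2)/Γ(ν+ρ+1)`. -/
theorem beta_type_integral_bound (ν ρ w : ℝ) (hρ : 0 < ρ) (hρν : ρ < ν) (hw : 0 < w) :
    (4*w) ^ ν * (∫ s in (0 : ℝ)..1,
        s ^ (ν - 1/2) * (1 - s) ^ (ν - 1/2) * (1 + 4*w*s) ^ (-ν - 3/2))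
      ≤ (4*w) ^ ρ * (Real.Gamma (ρ + 1/2) * Real.Gamma (ν + 1/2) / Real.Gamma (ν + ρ + 1)) := by
  have ha : 0 < ρ + 1/2 := by linarith
  have hb : 0 < ν + 1/2 := by linarith
  have h4w : 0 < 4 * w := by linarith
  rw [show ν + ρ + 1 = (ρ + 1/2) + (ν + 1/2) by ring, ← setIntegral_beta_integrand ha hb,
    intervalIntegral.integral_of_le zero_le_one, integral_Ioc_eq_integral_Ioo,
    ← MeasureTheory.integral_const_mul, ← MeasureTheory.integral_const_mul]
  refine integral_mono_of_nonneg ?_ ((integrableOn_beta_integrand ha hb).const_mul _) ?_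
  · filter_upwards [ae_restrict_mem measurableSet_Ioo] with s hs
    have h0 : 0 < s := hs.1
    have h1 : 0 < 1 - s := sub_pos.mpr hs.2
    simp only [Pi.zero_apply]
    positivity
  · filter_upwards [ae_restrict_mem measurableSet_Ioo] with s hs
    have h0 : 0 < s := hs.1
    have h1 : 0 < 1 - s := sub_pos.mpr hs.2
    calc (4*w) ^ ν * (s ^ (ν - 1/2) * (1 - s) ^ (ν - 1/2) * (1 + 4*w*s) ^ (-ν - 3/2))
        ≤ (4*w) ^ ν * (s ^ (ν - 1/2) * (1 - s) ^ (ν - 1/2) * (4*w*s) ^ (ρ - ν)) := by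
          gcongr
          exact one_add_rpow_le_rpow (by positivity) (by linarith) (by linarith)
      _ = ((4*w) ^ ν * (4*w) ^ (ρ - ν)) *
            ((s ^ (ν - 1/2) * s ^ (ρ - ν)) * (1 - s) ^ (ν - 1/2)) := by
          rw [mul_rpow h4w.le h0.le]
          ring
      _ = (4*w) ^ ρ * (s ^ (ρ + 1/2 - 1) * (1 - s) ^ (ν + 1/2 - 1)) := by
          rw [← rpow_add h4w, ← rpow_add h0]
          ring_nf
end

section
/- For all real numbers ν, ρ with 0 ≤ ν ≤ 3/2 and ρ ≥ ν, and all real r > 0 and t ≥ 1, setting z = r²/t², one has (1 + r²)^{-ρ} · ((2ν+1)/(π t²)) · (4z)^ν ∫₀^1 s^{ν - 1/2} (1-s)^{ν - 1/2} (1 + 4zs)^{-ν - 3/2} ds ≤ 32 · t^{-2 - 2ν}. -/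
open Real MeasureTheory intervalIntegral

theorem hasDerivAt_arcsin_two_mul_sub_one {s : ℝ} (hs : s ∈ Set.Ioo (0 : ℝ) 1) :
    HasDerivAt (fun x : ℝ => arcsin (2 * x - 1)) ((s * (1 - s)) ^ (-(1 / 2) : ℝ)) s := by
  obtain ⟨h0, h1⟩ := hs
  have hd : HasDerivAt (fun x : ℝ => 2 * x - 1) 2 s := by
    simpa using ((hasDerivAt_id s).const_mul 2).sub_const 1
  have hp : 0 < s * (1 - s) := mul_pos h0 (by linarith)
  refine ((hasDerivAt_arcsin (x := 2 * s - 1) (by linarith) (by linarith)).comp s hd).congr_deriv ?_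
  rw [rpow_neg hp.le, ← sqrt_eq_rpow,
    show 1 - (2 * s - 1) ^ 2 = 2 ^ 2 * (s * (1 - s)) by ring,
    sqrt_mul (by norm_num), sqrt_sq (by norm_num)]
  have := (sqrt_pos.2 hp).ne'
  field_simp

theorem intervalIntegrable_mul_one_sub_rpow_neg_half :
    IntervalIntegrable (fun s : ℝ => (s * (1 - s)) ^ (-(1 / 2) : ℝ)) volume 0 1 := by
  rw [intervalIntegrable_iff_integrableOn_Ioc_of_le zero_le_one]
  refine integrableOn_deriv_of_nonneg (g := fun x : ℝ => arcsin (2 * x - 1))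
    (continuous_arcsin.comp (by fun_prop)).continuousOn
    (fun s hs => hasDerivAt_arcsin_two_mul_sub_one hs) fun s hs => ?_
  exact rpow_nonneg (mul_nonneg hs.1.le (by linarith [hs.2])) _

theorem integral_mul_one_sub_rpow_neg_half :
    ∫ s in (0 : ℝ)..1, (s * (1 - s)) ^ (-(1 / 2) : ℝ) = π := by
  rw [integral_eq_sub_of_hasDerivAt_of_le zero_le_one
    (continuous_arcsin.comp (by fun_prop : Continuous fun x : ℝ => 2 * x - 1)).continuousOn
    (fun s hs => hasDerivAt_arcsin_two_mul_sub_one hs)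
    intervalIntegrable_mul_one_sub_rpow_neg_half]
  norm_num

theorem integral_partial_wave_le_pi {ν z : ℝ} (hν : 0 ≤ ν) (hz : 0 ≤ z) :
    ∫ s in (0 : ℝ)..1,
      s ^ (ν - 1/2) * (1 - s) ^ (ν - 1/2) * (1 + 4 * z * s) ^ (-ν - 3/2) ≤ π := by
  rw [← integral_mul_one_sub_rpow_neg_half]
  refine (le_norm_self _).trans (norm_integral_le_of_norm_le zero_le_one ?_
    intervalIntegrable_mul_one_sub_rpow_neg_half)
  filter_upwards [compl_mem_ae_iff.2 (measure_singleton (1 : ℝ))] with s hs1 hs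
  have h0 : 0 < s := hs.1
  have h1 : 0 < 1 - s := sub_pos.2 (lt_of_le_of_ne hs.2 hs1)
  have hp : 0 < s * (1 - s) := mul_pos h0 h1
  have hq : 1 ≤ 1 + 4 * z * s := le_add_of_nonneg_right (by positivity)
  rw [norm_of_nonneg (by positivity), ← mul_rpow h0.le h1.le]
  calc (s * (1 - s)) ^ (ν - 1/2) * (1 + 4 * z * s) ^ (-ν - 3/2)
      ≤ (s * (1 - s)) ^ (ν - 1/2) * 1 := by
        gcongr
        exact rpow_le_one_of_one_le_of_nonpos hq (by linarith)
    _ ≤ (s * (1 - s)) ^ (-(1 / 2) : ℝ) := by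
        rw [mul_one]
        exact rpow_le_rpow_of_exponent_ge hp (by nlinarith) (by linarith)

/-- Estimate in Lemma 3.1 for `0 ≤ ν ≤ 3/2`: for `ρ ≥ ν`, `r > 0`, `t ≥ 1` and
`z = r²/t²`,
`(1+r²)^{-ρ} ((2ν+1)/(πt²)) (4z)^ν ∫₀^1 s^{ν-1/2}(1-s)^{ν-1/2}(1+4zs)^{-ν-3/2} ds
  ≤ 32 t^{-2-2ν}`. -/
theorem small_nu_weighted_kernel_bound (ν ρ r t : ℝ) (hν0 : 0 ≤ ν) (hν : ν ≤ 3/2)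
    (hρ : ν ≤ ρ) (hr : 0 < r) (ht : 1 ≤ t) :
    (1 + r^2) ^ (-ρ) * ((2*ν + 1) / (π * t^2)) * (4 * (r^2 / t^2)) ^ ν *
        (∫ s in (0 : ℝ)..1,
          s ^ (ν - 1/2) * (1 - s) ^ (ν - 1/2) * (1 + 4 * (r^2 / t^2) * s) ^ (-ν - 3/2))
      ≤ 32 * t ^ (-2 - 2*ν) := by
  have ht0 : 0 < t := by linarith
  have hI := integral_partial_wave_le_pi (z := r^2 / t^2) hν0 (by positivity)
  have hweight : (1 + r^2) ^ (-ρ) * (r^2) ^ ν ≤ 1 := by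
    calc (1 + r^2) ^ (-ρ) * (r^2) ^ ν ≤ (1 + r^2) ^ (-ν) * (1 + r^2) ^ ν := by
          gcongr
          · nlinarith
          · linarith
      _ = 1 := by rw [← rpow_add (by positivity), neg_add_cancel, rpow_zero]
  have hfour : (4 : ℝ) ^ ν ≤ 8 := by
    calc (4 : ℝ) ^ ν ≤ 4 ^ (3/2 : ℝ) := rpow_le_rpow_of_exponent_le (by norm_num) hν
      _ = 8 := by
        rw [show (4 : ℝ) = 2 ^ (2 : ℝ) by norm_num, ← rpow_mul (by norm_num)]
        norm_num
  have htpow : t ^ (-2 - 2*ν) = (t^2)⁻¹ * ((t^2) ^ ν)⁻¹ := by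
    rw [← rpow_natCast, ← rpow_mul ht0.le, ← rpow_neg ht0.le, ← rpow_neg ht0.le,
      ← rpow_add ht0]
    congr 1
  calc _ ≤ (1 + r^2) ^ (-ρ) * ((2*ν + 1) / (π * t^2)) * (4 * (r^2 / t^2)) ^ ν * π := by
        gcongr
    _ = ((1 + r^2) ^ (-ρ) * (r^2) ^ ν) * ((2*ν + 1) * 4 ^ ν) * t ^ (-2 - 2*ν) := by
        rw [htpow, mul_rpow (by norm_num) (by positivity),
          div_rpow (by positivity) (by positivity)]
        field_simp
    _ ≤ 1 * (4 * 8) * t ^ (-2 - 2*ν) := by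
        gcongr
        linarith
    _ = 32 * t ^ (-2 - 2*ν) := by norm_num
end
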